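/- arXiv:1411.7118 — 3 statements merged into one kernel-verified Lean document; each statement's English description precedes it below -/
import Mathlib

section
/- There exists g in the semigroup J such that the cone g + C_X is saturated, i.e. (g + C_X) ∩ J = (g + C_X) ∩ L. -/
open scoped BigOperators RealInnerProductSpace
open Filter Topology

noncomputable section

/-- `Euc s` is the Euclidean space `ℝ^s`. -/
abbrev Euc (s : ℕ) := EuclideanSpace ℝ (Fin s)

/-- The additive semigroup `X₁ℕ + ⋯ + X_mℕ` generated by the vectors `X j`. -/
def sgOf {s : ℕ} {ι : Type*} [Fintype ι] (X : ι → Euc s) : Set (Euc s) :=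
  {z | ∃ u : ι → ℕ, ∑ j, (u j : ℝ) • X j = z}

/-- The lattice `X₁ℤ + ⋯ + X_mℤ` generated by the vectors `X j`. -/
def latOf {s : ℕ} {ι : Type*} [Fintype ι] (X : ι → Euc s) : Set (Euc s) :=
  {z | ∃ u : ι → ℤ, ∑ j, (u j : ℝ) • X j = z}

/-- The convex cone `X₁ℝ⁺ + ⋯ + X_mℝ⁺` generated by the vectors `X j`. -/
def coneOf {s : ℕ} {ι : Type*} [Fintype ι] (X : ι → Euc s) : Set (Euc s) :=
  {x | ∃ c : ι → ℝ, (∀ j, 0 ≤ c j) ∧ ∑ j, c j • X j = x}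

/-- The multiplicity of `z`: the number of finite words `i₁…i_n` with
`X_{i₁} + ⋯ + X_{i_n} = z`. -/
def mult {s : ℕ} {ι : Type*} [Fintype ι] (X : ι → Euc s) (z : Euc s) : ℕ :=
  Set.ncard {w : List ι | (w.map X).sum = z}

/-- The multiplicity extended to the cone: the minimum of `mult X z` over points
`z` of the semigroup nearest to `x`. -/
def multC {s : ℕ} {ι : Type*} [Fintype ι] (X : ι → Euc s) (x : Euc s) : ℕ :=
  sInf {n | ∃ z ∈ sgOf X, dist x z = Metric.infDist x (sgOf X) ∧ mult X z = n}

/-- All the vectors `X j` have integer coordinates. -/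
def IntegralVecs {s : ℕ} {ι : Type*} (X : ι → Euc s) : Prop :=
  ∀ j i, ∃ n : ℤ, X j i = (n : ℝ)

/-- The entropy `h(p) = -∑ p_j log p_j` of a probability vector. -/
def entropy {m : ℕ} (p : Fin m → ℝ) : ℝ := -∑ j, p j * Real.log (p j)

/-- The `p`-th iteration of `X`: all sums `X_{ω₁} + ⋯ + X_{ω_p}` over words `ω`. -/
def iter {s m : ℕ} (X : Fin m → Euc s) (p : ℕ) : (Fin p → Fin m) → Euc s :=
  fun ω => ∑ i, X (ω i)

/-- There exists `g` in the semigroup `J` such that the cone `g + C_X` is saturated: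
`(g + C_X) ∩ J = (g + C_X) ∩ L`. -/
theorem stmt0 {s m : ℕ} (hs : 1 ≤ s) (hm : 2 ≤ m) (X : Fin m → Euc s)
    (hint : IntegralVecs X)
    (hspan : Submodule.span ℝ (Set.range X) = ⊤)
    (α : Euc s) (hα : ∀ j, 0 < ⟪X j, α⟫) :
    ∃ g ∈ sgOf X,
      ((g + ·) '' coneOf X) ∩ sgOf X = ((g + ·) '' coneOf X) ∩ latOf X := by
  classical
  have hfin : ({y : Euc s | ∃ c : Fin m → ℝ, (∀ j, 0 ≤ c j ∧ c j ≤ 1) ∧ ∑ j, c j • X j = y}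
      ∩ latOf X).Finite := by
    choose n hn using hint
    let B : Fin s → ℤ := fun i => ∑ j, |n j i|
    refine Set.Finite.subset ((Set.finite_Icc (-B) B).image
      (fun v : Fin s → ℤ => (WithLp.toLp 2 (fun i => (v i : ℝ)) : Euc s))) ?_
    rintro y ⟨⟨c, hc, hcy⟩, u, hu⟩
    have key : ∀ i, ((∑ j, u j * n j i : ℤ) : ℝ) = ∑ j, c j * (n j i : ℝ) := by
      intro i
      have h1 : (∑ j, (u j : ℝ) • X j) i = (∑ j, c j • X j) i := by rw [hu, hcy]
      simp only [WithLp.ofLp_sum, Finset.sum_apply, PiLp.smul_apply, smul_eq_mul, hn] at h1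
      push_cast
      exact h1
    have bd : ∀ i, |∑ j, u j * n j i| ≤ B i := by
      intro i
      have h2 : |((∑ j, u j * n j i : ℤ) : ℝ)| ≤ ((B i : ℤ) : ℝ) := by
        rw [key]
        refine (Finset.abs_sum_le_sum_abs _ _).trans ?_
        simp only [B]
        push_cast
        refine Finset.sum_le_sum fun j _ => ?_
        rw [abs_mul, abs_of_nonneg (hc j).1]
        exact mul_le_of_le_one_left (abs_nonneg _) (hc j).2
      exact_mod_cast h2
    refine ⟨fun i => ∑ j, u j * n j i, ⟨fun i => (abs_le.1 (bd i)).1,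
      fun i => (abs_le.1 (bd i)).2⟩, ?_⟩
    ext i
    rw [← hu]
    simp [hn]
  have hch : ∀ y : Euc s, ∃ u : Fin m → ℤ, y ∈ latOf X → ∑ j, (u j : ℝ) • X j = y := by
    intro y
    by_cases h : y ∈ latOf X
    · obtain ⟨u, hu⟩ := h
      exact ⟨u, fun _ => hu⟩
    · exact ⟨0, fun h' => absurd h' h⟩
  choose U hU using hch
  let N : ℕ := ∑ y ∈ hfin.toFinset, ∑ j, (U y j).natAbs
  have hN : ∀ y ∈ hfin.toFinset, ∀ j, (U y j).natAbs ≤ N := by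
    intro y hy j
    exact (Finset.single_le_sum (f := fun j => (U y j).natAbs)
      (fun _ _ => Nat.zero_le _) (Finset.mem_univ j)).trans
      (Finset.single_le_sum (f := fun y => ∑ j, (U y j).natAbs)
      (fun _ _ => Nat.zero_le _) hy)
  refine ⟨∑ j, (N : ℝ) • X j, ⟨fun _ => N, rfl⟩, ?_⟩
  ext z
  constructor
  · rintro ⟨h1, u, hu⟩
    exact ⟨h1, fun j => (u j : ℤ), by simpa using hu⟩
  · rintro ⟨⟨x, ⟨c, hc, hcx⟩, hxz⟩, u, hu⟩
    refine ⟨⟨x, ⟨c, hc, hcx⟩, hxz⟩, ?_⟩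
    simp only at hxz
    set y : Euc s := ∑ j, Int.fract (c j) • X j with hy
    have hxy : x = ∑ j, ((⌊c j⌋ : ℤ) : ℝ) • X j + y := by
      rw [hy, ← hcx, ← Finset.sum_add_distrib]
      refine Finset.sum_congr rfl fun j _ => ?_
      rw [← add_smul, Int.floor_add_fract]
    have hyL : y ∈ latOf X := by
      refine ⟨fun j => u j - N - ⌊c j⌋, ?_⟩
      have : y = z - ∑ j, (N : ℝ) • X j - ∑ j, ((⌊c j⌋ : ℤ) : ℝ) • X j := by
        rw [← hxz, hxy]; abel
      rw [this, ← hu, ← Finset.sum_sub_distrib, ← Finset.sum_sub_distrib]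
      refine Finset.sum_congr rfl fun j _ => ?_
      push_cast
      rw [sub_smul, sub_smul]
    have hyF : y ∈ hfin.toFinset := by
      rw [Set.Finite.mem_toFinset]
      exact ⟨⟨fun j => Int.fract (c j), fun j => ⟨Int.fract_nonneg _,
        (Int.fract_lt_one _).le⟩, rfl⟩, hyL⟩
    have hpos : ∀ j, 0 ≤ (N : ℤ) + ⌊c j⌋ + U y j := by
      intro j
      have h1 := hN y hyF j
      have h2 : 0 ≤ ⌊c j⌋ := Int.floor_nonneg.2 (hc j)
      omega
    refine ⟨fun j => ((N : ℤ) + ⌊c j⌋ + U y j).toNat, ?_⟩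
    have hz : z = ∑ j, (N : ℝ) • X j + (∑ j, ((⌊c j⌋ : ℤ) : ℝ) • X j
        + ∑ j, (U y j : ℝ) • X j) := by
      rw [hU y hyL, ← hxy, hxz]
    rw [hz, ← Finset.sum_add_distrib, ← Finset.sum_add_distrib]
    refine Finset.sum_congr rfl fun j _ => ?_
    have h3 : ((((N : ℤ) + ⌊c j⌋ + U y j).toNat : ℕ) : ℝ)
        = (N : ℝ) + (⌊c j⌋ : ℝ) + (U y j : ℝ) := by
      have := Int.toNat_of_nonneg (hpos j)
      exact_mod_cast congrArg (Int.cast : ℤ → ℝ) this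
    rw [h3, add_smul, add_smul, add_assoc]
end
end

section
/- For every integer C₀ ≥ 1 there exists a polynomial Q with positive coefficients such that for all z, z' ∈ J with ‖z − z'‖ ≤ C₀, one has 1/Q(‖z‖) ≤ m(z)/m(z') ≤ Q(‖z‖). -/
open scoped BigOperators RealInnerProductSpace
open Filter Topology

noncomputable section

/-- Words of sum `z` and length at most `L` that contain the letters of `a`. -/
def subWords {s m : ℕ} (X : Fin m → Euc s) (L : ℕ) (a : List (Fin m)) (z : Euc s) :
    Set (List (Fin m)) :=
  {w | (w.map X).sum = z ∧ (∀ j, a.count j ≤ w.count j) ∧ w.length ≤ L}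

lemma subWords_finite {s m : ℕ} (X : Fin m → Euc s) (L : ℕ) (a : List (Fin m)) (z : Euc s) :
    (subWords X L a z).Finite :=
  (List.finite_length_le (Fin m) L).subset fun _ hw => hw.2.2

lemma subWords_cons {s m : ℕ} (X : Fin m → Euc s) (L : ℕ) (j : Fin m) (a : List (Fin m))
    (z : Euc s) :
    (subWords X L (j :: a) z).ncard ≤ (L + 1) * (subWords X L a (z - X j)).ncard := by
  have hsub : subWords X L (j :: a) z ⊆
      (fun p : ℕ × List (Fin m) => p.2.insertIdx p.1 j) ''
        ((Set.Iio (L + 1)) ×ˢ (subWords X L a (z - X j))) := by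
    rintro w ⟨h1, h2, h3⟩
    have hj : j ∈ w := by
      have := h2 j
      rw [List.count_cons_self] at this
      exact List.count_pos_iff.1 (by omega)
    obtain ⟨l1, l2, rfl⟩ := List.append_of_mem hj
    refine ⟨(l1.length, l1 ++ l2), ⟨?_, ?_, ?_, ?_⟩, ?_⟩
    · simp only [List.length_append, List.length_cons] at h3
      simp only [Set.mem_Iio]; omega
    · rw [← h1]
      simp only [List.map_append, List.sum_append, List.map_cons, List.sum_cons]
      abel
    · intro k
      have := h2 k
      simp only [List.count_append, List.count_cons] at this ⊢
      omega
    · simp only [List.length_append, List.length_cons] at h3 ⊢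
      omega
    · change (l1 ++ l2).insertIdx l1.length j = l1 ++ j :: l2
      clear h1 h2 h3 hj
      induction l1 with
      | nil => simp
      | cons i l ih => simpa using ih
  have hfin : ((Set.Iio (L + 1)) ×ˢ (subWords X L a (z - X j))).Finite :=
    (Set.finite_Iio _).prod (subWords_finite _ _ _ _)
  refine (Set.ncard_le_ncard hsub (hfin.image _)).trans ((Set.ncard_image_le hfin).trans ?_)
  rw [Set.ncard_prod]
  simp [Set.ncard_eq_toFinset_card']

lemma words_finite {s m : ℕ} (X : Fin m → Euc s) (L : ℕ) (z : Euc s)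
    (hL : ∀ w : List (Fin m), (w.map X).sum = z → w.length ≤ L) :
    {w : List (Fin m) | (w.map X).sum = z}.Finite :=
  (List.finite_length_le (Fin m) L).subset fun w hw => hL w hw

lemma subWords_le {s m : ℕ} (X : Fin m → Euc s)
    (hf : ∀ z, {w : List (Fin m) | (w.map X).sum = z}.Finite) (L : ℕ) (a : List (Fin m)) :
    ∀ (z : Euc s),
    (subWords X L a z).ncard ≤ (L + 1) ^ a.length * mult X (z - (a.map X).sum) := by
  induction a with
  | nil =>
    intro z
    simp only [List.length_nil, pow_zero, one_mul, List.map_nil, List.sum_nil, sub_zero]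
    exact Set.ncard_le_ncard (fun w hw => hw.1) (hf z)
  | cons j a ih =>
    intro z
    refine (subWords_cons X L j a z).trans ?_
    refine (Nat.mul_le_mul_left _ (ih (z - X j))).trans ?_
    rw [List.length_cons, pow_succ', List.map_cons, List.sum_cons, sub_sub, mul_assoc]

lemma mult_mono {s m : ℕ} (X : Fin m → Euc s)
    (hf : ∀ z, {w : List (Fin m) | (w.map X).sum = z}.Finite) (b : List (Fin m)) (z z' : Euc s)
    (h : z + (b.map X).sum = z') : mult X z ≤ mult X z' := by
  refine Set.ncard_le_ncard_of_injOn (fun w => b ++ w) ?_ ?_ (hf z')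
  · intro w hw
    simp only [Set.mem_ofPred_eq] at hw ⊢
    rw [List.map_append, List.sum_append, hw, ← h, add_comm]
  · intro w _ w' _ h
    exact List.append_cancel_left h

lemma sum_map_count {s m : ℕ} (X : Fin m → Euc s) (w : List (Fin m)) :
    (w.map X).sum = ∑ j, (w.count j : ℝ) • X j := by
  induction w with
  | nil => simp
  | cons i w ih =>
    rw [List.map_cons, List.sum_cons, ih]
    simp only [List.count_cons, Nat.cast_add, add_smul, Finset.sum_add_distrib]
    rw [add_comm]
    congr 1
    simp [Finset.sum_ite_eq]

lemma exists_list_count {m : ℕ} (u : Fin m → ℕ) : ∃ l : List (Fin m), ∀ j, l.count j = u j := by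
  refine ⟨(∑ j, u j • ({j} : Multiset (Fin m))).toList, fun j => ?_⟩
  rw [← Multiset.coe_count, Multiset.coe_toList, Multiset.count_sum']
  simp [Multiset.count_singleton]

/-- Dickson: finitely many elementary modifications suffice. -/
lemma exists_moves {s m : ℕ} (X : Fin m → Euc s) (hint : IntegralVecs X) (C₀ : ℕ) :
    ∃ T : Finset (List (Fin m) × List (Fin m)), ∀ u v : Fin m → ℕ,
      ‖(∑ j, (u j : ℝ) • X j) - ∑ j, (v j : ℝ) • X j‖ ≤ C₀ →
      ∃ p ∈ T, (∀ j, p.1.count j ≤ u j) ∧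
        (∑ j, (u j : ℝ) • X j) - (p.1.map X).sum + (p.2.map X).sum = ∑ j, (v j : ℝ) • X j := by
  classical
  let Y : (Fin m → ℕ) → Euc s := fun u => ∑ j, (u j : ℝ) • X j
  have hYint : ∀ u i, ∃ n : ℤ, Y u i = n := by
    intro u i
    choose n hn using hint
    refine ⟨∑ j, (u j : ℤ) * n j i, ?_⟩
    simp [Y, hn]
  let D : Set (Euc s) := {d | ‖d‖ ≤ C₀ ∧ ∀ i, ∃ n : ℤ, d i = n}
  have hD : D.Finite := by
    refine ((Set.finite_Icc (fun _ : Fin s => -(C₀ : ℤ)) (fun _ => (C₀ : ℤ))).image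
      (fun n => (WithLp.toLp 2 (fun i => (n i : ℝ)) : Euc s))).subset ?_
    rintro d ⟨hd, hi⟩
    choose n hn using hi
    have hb : ∀ i, |n i| ≤ (C₀ : ℤ) := by
      intro i
      have h1 : ‖d i‖ ≤ ‖d‖ := PiLp.norm_apply_le d i
      rw [hn i, Real.norm_eq_abs] at h1
      have := h1.trans hd
      exact_mod_cast this
    refine ⟨n, ⟨fun i => (abs_le.1 (hb i)).1, fun i => (abs_le.1 (hb i)).2⟩, ?_⟩
    ext i
    simp [hn]
  let S : Euc s → Set ((Fin m → ℕ) × (Fin m → ℕ)) := fun d => {p | Y p.1 - Y p.2 = d}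
  let M : Euc s → Set ((Fin m → ℕ) × (Fin m → ℕ)) := fun d => {p | Minimal (· ∈ S d) p}
  have hM : ∀ d, (M d).Finite := fun d =>
    WellQuasiOrderedLE.finite_of_isAntichain (setOfPred_minimal_antichain _)
  choose f hf using fun u : Fin m → ℕ => exists_list_count u
  have hfY : ∀ u, ((f u).map X).sum = Y u := by
    intro u
    rw [sum_map_count]
    simp [Y, hf]
  have hT : (⋃ d ∈ D, (fun p : (Fin m → ℕ) × (Fin m → ℕ) => (f p.1, f p.2)) '' M d).Finite :=
    hD.biUnion fun d _ => (hM d).image _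
  refine ⟨hT.toFinset, fun u v huv => ?_⟩
  have hmem : (u, v) ∈ S (Y u - Y v) := rfl
  obtain ⟨p, hp1, hp2⟩ := exists_minimal_le_of_wellFoundedLT (· ∈ S (Y u - Y v)) (u, v) hmem
  refine ⟨(f p.1, f p.2), ?_, ?_, ?_⟩
  · rw [Set.Finite.mem_toFinset]
    refine Set.mem_biUnion (x := Y u - Y v) ⟨huv, fun i => ?_⟩ ⟨p, hp2, rfl⟩
    obtain ⟨a, ha⟩ := hYint u i
    obtain ⟨b, hb⟩ := hYint v i
    exact ⟨a - b, by simp [ha, hb]⟩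
  · intro j
    rw [hf]
    exact hp1.1 j
  · simp only [hfY]
    have h : Y p.1 - Y p.2 = Y u - Y v := hp2.1
    change Y u - Y p.1 + Y p.2 = Y v
    rw [sub_add, h, sub_sub_cancel]

lemma mult_le {s m : ℕ} (X : Fin m → Euc s) (hint : IntegralVecs X)
    (hf : ∀ z, {w : List (Fin m) | (w.map X).sum = z}.Finite) (C₀ : ℕ) :
    ∃ F K : ℕ, 1 ≤ F ∧ ∀ z, ∀ z' ∈ sgOf X, ‖z - z'‖ ≤ C₀ → ∀ L : ℕ,
      (∀ w : List (Fin m), (w.map X).sum = z → w.length ≤ L) →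
      mult X z ≤ F * (L + 1) ^ K * mult X z' := by
  classical
  obtain ⟨T, hT⟩ := exists_moves X hint C₀
  refine ⟨T.card + 1, T.sup fun p => p.1.length, by omega, fun z z' hz' hzz L hL => ?_⟩
  set K := T.sup fun p => p.1.length
  obtain ⟨v, rfl⟩ := hz'
  set z' := ∑ j, (v j : ℝ) • X j
  let T' := T.filter fun p => z - (p.1.map X).sum + (p.2.map X).sum = z'
  have hsub : {w : List (Fin m) | (w.map X).sum = z} ⊆ ⋃ p ∈ T', subWords X L p.1 z := by
    intro w hw
    have hw' : (w.map X).sum = z := hw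
    have hwz : ∑ j, (w.count j : ℝ) • X j = z := by rw [← sum_map_count, hw']
    obtain ⟨p, hp, h1, h2⟩ := hT (fun j => w.count j) v (by rw [hwz]; exact hzz)
    rw [hwz] at h2
    exact Set.mem_biUnion (x := p) (Finset.mem_coe.2 (Finset.mem_filter.2 ⟨hp, h2⟩))
      ⟨hw', h1, hL w hw'⟩
  have hfin : (⋃ p ∈ T', subWords X L p.1 z).Finite :=
    T'.finite_toSet.biUnion fun p _ => subWords_finite _ _ _ _
  calc mult X z ≤ (⋃ p ∈ T', subWords X L p.1 z).ncard := Set.ncard_le_ncard hsub hfin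
    _ ≤ ∑ p ∈ T', (subWords X L p.1 z).ncard := Finset.set_ncard_biUnion_le _ _
    _ ≤ ∑ p ∈ T', (L + 1) ^ K * mult X z' := by
        refine Finset.sum_le_sum fun p hp => ?_
        obtain ⟨hpT, hpz⟩ := Finset.mem_filter.1 hp
        refine (subWords_le X hf L p.1 z).trans ?_
        refine Nat.mul_le_mul (Nat.pow_le_pow_right (by omega) ?_) (mult_mono X hf p.2 _ _ hpz)
        exact Finset.le_sup (f := fun p : List (Fin m) × List (Fin m) => p.1.length) hpT
    _ = T'.card * ((L + 1) ^ K * mult X z') := by simp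
    _ ≤ (T.card + 1) * ((L + 1) ^ K * mult X z') :=
        Nat.mul_le_mul_right _ ((Finset.card_filter_le _ _).trans (by omega))
    _ = _ := by ring

lemma length_bound {s m : ℕ} (X : Fin m → Euc s) (α : Euc s) (hα : ∀ j, 0 < ⟪X j, α⟫) :
    ∃ c : ℝ, 0 ≤ c ∧ ∀ w : List (Fin m), (w.length : ℝ) ≤ c * ‖(w.map X).sum‖ := by
  obtain ⟨e, he, hle⟩ : ∃ e : ℝ, 0 < e ∧ ∀ j, e ≤ ⟪X j, α⟫ := by
    rcases isEmpty_or_nonempty (Fin m) with h | h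
    · exact ⟨1, one_pos, fun j => h.elim j⟩
    · obtain ⟨j, hj⟩ := Finite.exists_min fun j => ⟪X j, α⟫
      exact ⟨_, hα j, hj⟩
  refine ⟨‖α‖ / e, by positivity, fun w => ?_⟩
  have h1 : (w.length : ℝ) * e ≤ ⟪(w.map X).sum, α⟫ := by
    induction w with
    | nil => simp
    | cons i w ih =>
      rw [List.map_cons, List.sum_cons, inner_add_left, List.length_cons]
      push_cast
      linarith [hle i]
  have h2 := real_inner_le_norm (w.map X).sum α
  rw [div_mul_eq_mul_div, le_div_iff₀ he]
  linarith [mul_comm ‖α‖ ‖(w.map X).sum‖]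

/-- For every integer `C₀ ≥ 1` there is a polynomial `Q` with positive coefficients
such that `1/Q(‖z‖) ≤ m(z)/m(z') ≤ Q(‖z‖)` whenever `z, z' ∈ J` and `‖z - z'‖ ≤ C₀`. -/
theorem stmt5 {s m : ℕ} (hs : 1 ≤ s) (hm : 2 ≤ m) (X : Fin m → Euc s)
    (hint : IntegralVecs X)
    (hspan : Submodule.span ℝ (Set.range X) = ⊤)
    (α : Euc s) (hα : ∀ j, 0 < ⟪X j, α⟫)
    (C₀ : ℕ) (hC₀ : 1 ≤ C₀) :
    ∃ Q : Polynomial ℝ, (∀ i ≤ Q.natDegree, 0 < Q.coeff i) ∧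
      ∀ z ∈ sgOf X, ∀ z' ∈ sgOf X, ‖z - z'‖ ≤ (C₀ : ℝ) →
        1 / Q.eval ‖z‖ ≤ (mult X z : ℝ) / (mult X z' : ℝ) ∧
        (mult X z : ℝ) / (mult X z' : ℝ) ≤ Q.eval ‖z‖ := by
  obtain ⟨c, hc, hlen⟩ := length_bound X α hα
  have hL : ∀ z : Euc s, ∀ w : List (Fin m), (w.map X).sum = z → w.length ≤ ⌊c * ‖z‖⌋₊ := by
    rintro z w rfl
    exact Nat.le_floor (hlen w)
  have hf : ∀ z, {w : List (Fin m) | (w.map X).sum = z}.Finite := fun z =>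
    words_finite X _ z (hL z)
  obtain ⟨F, K, hF, hmain⟩ := mult_le X hint hf C₀
  have hF' : (0 : ℝ) < F := by exact_mod_cast hF
  set B : ℝ := c + c * C₀ + 1
  have hB : 0 < B := by positivity
  have hpos : ∀ z ∈ sgOf X, (0 : ℝ) < mult X z := by
    rintro z ⟨u, rfl⟩
    obtain ⟨l, hl⟩ := exists_list_count u
    have : 0 < mult X (∑ j, (u j : ℝ) • X j) := by
      refine (Set.ncard_pos (hf _)).2 ⟨l, ?_⟩
      simp [sum_map_count, hl]
    exact_mod_cast this
  -- the real form of the main inequality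
  have key : ∀ z, ∀ z' ∈ sgOf X, ‖z - z'‖ ≤ (C₀ : ℝ) → ∀ t : ℝ, 0 ≤ t → ‖z‖ ≤ t + C₀ →
      (mult X z : ℝ) ≤ F * B ^ K * (t + 1) ^ K * mult X z' := by
    intro z z' hz' hzz t ht hzt
    have h1 : (mult X z : ℝ) ≤ F * ((⌊c * ‖z‖⌋₊ : ℝ) + 1) ^ K * mult X z' := by
      exact_mod_cast hmain z z' hz' hzz _ (hL z)
    have h2 : (⌊c * ‖z‖⌋₊ : ℝ) + 1 ≤ B * (t + 1) := by
      have h3 : (⌊c * ‖z‖⌋₊ : ℝ) ≤ c * ‖z‖ := Nat.floor_le (by positivity)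
      have h4 : c * ‖z‖ ≤ c * (t + C₀) := mul_le_mul_of_nonneg_left hzt hc
      have h5 : 0 ≤ c * C₀ * t := by positivity
      simp only [B]
      nlinarith
    refine h1.trans ?_
    rw [mul_assoc (F : ℝ) (B ^ K), ← mul_pow]
    gcongr
  refine ⟨Polynomial.C (F * B ^ K) * (Polynomial.X + 1) ^ K, ?_, ?_⟩
  · intro i hi
    rw [Polynomial.coeff_C_mul, Polynomial.coeff_X_add_one_pow]
    have hiK : i ≤ K := by
      refine hi.trans ((Polynomial.natDegree_C_mul_le _ _).trans ?_)
      refine (Polynomial.natDegree_pow_le).trans ?_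
      rw [← Polynomial.C_1, Polynomial.natDegree_X_add_C, mul_one]
    have : 0 < K.choose i := Nat.choose_pos hiK
    positivity
  · intro z hz z' hz' hzz
    have ev : Polynomial.eval ‖z‖ (Polynomial.C (F * B ^ K) * (Polynomial.X + 1) ^ K)
        = F * B ^ K * (‖z‖ + 1) ^ K := by simp
    rw [ev]
    have p1 := hpos z hz
    have p2 := hpos z' hz'
    have hQ : 0 < F * B ^ K * (‖z‖ + 1) ^ K := by positivity
    constructor
    · rw [div_le_div_iff₀ hQ p2, one_mul, mul_comm]
      refine key z' z hz (by rwa [norm_sub_rev]) _ (norm_nonneg _) ?_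
      have := norm_sub_norm_le z' z
      rw [norm_sub_rev] at this
      linarith
    · rw [div_le_iff₀ p2]
      exact key z z' hz' hzz _ (norm_nonneg _) (by linarith [(Nat.cast_nonneg C₀ : (0:ℝ) ≤ C₀)])
end
end

section
/- Suppose X = {X₁,…,X_m} and Y = {Y₁,…,Y_{m'}} are both η-coplanar for the same η ∈ ℝ^s, they generate the same cone C_X = C_Y, and they define the same directional growth function γ_X = γ_Y on unit vectors of this common cone. Then m = m' and X is a permutation of Y (the multisets {X₁,…,X_m} and {Y₁,…,Y_{m'}} coincide). -/
open scoped BigOperators RealInnerProductSpace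
open Filter Topology

noncomputable section

section RigidityHelpers

variable {s m : ℕ}

/-- Coordinates of semigroup points are integers. -/
lemma sg_int (X : Fin m → Euc s) (hX : IntegralVecs X) {z : Euc s} (hz : z ∈ sgOf X) (i : Fin s) :
    ∃ n : ℤ, z i = n := by
  obtain ⟨u, rfl⟩ := hz
  choose c hc using hX
  refine ⟨∑ j, (u j : ℤ) * c j i, ?_⟩
  simp [hc]

lemma sg_sep (X : Fin m → Euc s) (hX : IntegralVecs X) {z w : Euc s} (hz : z ∈ sgOf X)
    (hw : w ∈ sgOf X) (hne : z ≠ w) : 1 ≤ dist z w := by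
  have : ∃ i, z i ≠ w i := by
    by_contra! h
    exact hne (by ext i; exact h i)
  obtain ⟨i, hi⟩ := this
  obtain ⟨a, ha⟩ := sg_int X hX hz i
  obtain ⟨b, hb⟩ := sg_int X hX hw i
  have h1 : ‖(z - w) i‖ ≤ ‖z - w‖ := PiLp.norm_apply_le _ i
  rw [dist_eq_norm]
  refine le_trans ?_ h1
  rw [PiLp.sub_apply, ha, hb, Real.norm_eq_abs]
  rw [ha, hb] at hi
  have : a - b ≠ 0 := fun h => hi (by rw [sub_eq_zero.mp h])
  exact_mod_cast Int.one_le_abs this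

lemma sg_zero (X : Fin m → Euc s) : (0 : Euc s) ∈ sgOf X := ⟨0, by simp⟩

lemma sg_closed (X : Fin m → Euc s) (hX : IntegralVecs X) : IsClosed (sgOf X) :=
  Metric.isClosed_of_pairwise_le_dist one_pos
    (fun _ hz _ hw hne => sg_sep X hX hz hw hne)

lemma multC_spec (X : Fin m → Euc s) (hX : IntegralVecs X) (x : Euc s) :
    ∃ z ∈ sgOf X, dist x z = Metric.infDist x (sgOf X) ∧ mult X z = multC X x := by
  obtain ⟨z, hz, h⟩ := (sg_closed X hX).exists_infDist_eq_dist ⟨0, sg_zero X⟩ x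
  have : multC X x ∈ {n | ∃ z ∈ sgOf X, dist x z = Metric.infDist x (sgOf X) ∧ mult X z = n} :=
    Nat.sInf_mem ⟨_, z, hz, h.symm, rfl⟩
  exact this

lemma multC_near (X : Fin m → Euc s) (hX : IntegralVecs X) (x z : Euc s) (hz : z ∈ sgOf X)
    (h : dist x z < 1 / 2) : multC X x = mult X z := by
  obtain ⟨w, hw, h1, h2⟩ := multC_spec X hX x
  have h3 : dist x w ≤ dist x z := h1 ▸ Metric.infDist_le_dist_of_mem hz
  have : z = w := by
    by_contra hne
    have := sg_sep X hX hz hw hne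
    have := dist_triangle_left z w x
    linarith
  rw [← h2, this]

lemma inner_list (X : Fin m → Euc s) (η : Euc s) (hη : ∀ j, ⟪η, X j⟫ = 1) (w : List (Fin m)) :
    ⟪η, (w.map X).sum⟫ = w.length := by
  induction w with
  | nil => simp
  | cons a w ih => simp [inner_add_right, ih, hη]; ring

lemma list_sg (X : Fin m → Euc s) (w : List (Fin m)) : (w.map X).sum ∈ sgOf X := by
  induction w with
  | nil => simpa using sg_zero X
  | cons a w ih =>
    obtain ⟨u, hu⟩ := ih
    refine ⟨u + Pi.single a 1, ?_⟩
    simp [add_smul, Finset.sum_add_distrib, hu, Pi.single_apply, add_comm, ite_smul]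

lemma sg_list (X : Fin m → Euc s) {z : Euc s} (hz : z ∈ sgOf X) :
    ∃ w : List (Fin m), (w.map X).sum = z := by
  obtain ⟨u, rfl⟩ := hz
  refine ⟨(List.finRange m).flatMap (fun j => List.replicate (u j) j), ?_⟩
  rw [List.map_flatMap, ← List.sum_ofFn, List.ofFn_eq_map]
  induction List.finRange m with
  | nil => simp
  | cons a l ih =>
    rw [List.flatMap_cons, List.sum_append, ih]
    simp [Nat.cast_smul_eq_nsmul]

/-- The words of a coplanar family with a given sum, as functions. -/
lemma mult_set (X : Fin m → Euc s) (η : Euc s) (hη : ∀ j, ⟪η, X j⟫ = 1) (n : ℕ) (z : Euc s)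
    (hz : ⟪η, z⟫ = n) :
    {w : List (Fin m) | (w.map X).sum = z} =
      List.ofFn '' {f : Fin n → Fin m | ∑ i, X (f i) = z} := by
  ext w
  constructor
  · intro hw
    have hw : (w.map X).sum = z := hw
    have hl : w.length = n := by
      have := inner_list X η hη w
      rw [hw, hz] at this
      exact_mod_cast this.symm
    subst hl
    refine ⟨w.get, ?_, List.ofFn_get w⟩
    show ∑ i, X (w.get i) = z
    rw [← hw, ← List.sum_ofFn]
    conv_rhs => rw [← List.ofFn_get w, List.map_ofFn]
    rfl
  · rintro ⟨f, hf, rfl⟩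
    have hf : ∑ i, X (f i) = z := hf
    show ((List.ofFn f).map X).sum = z
    rw [List.map_ofFn, List.sum_ofFn, ← hf]
    rfl

open Classical in
lemma mult_eq (X : Fin m → Euc s) (η : Euc s) (hη : ∀ j, ⟪η, X j⟫ = 1) (n : ℕ) (z : Euc s)
    (hz : ⟪η, z⟫ = n) :
    mult X z = (Finset.univ.filter (fun f : Fin n → Fin m => ∑ i, X (f i) = z)).card := by
  rw [mult, mult_set X η hη n z hz, Set.ncard_image_of_injective _ List.ofFn_injective]
  rw [← Set.ncard_coe_finset]
  simp

lemma sg_level (X : Fin m → Euc s) (η : Euc s) (hη : ∀ j, ⟪η, X j⟫ = 1) {z : Euc s}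
    (hz : z ∈ sgOf X) : ∃ n : ℕ, ⟪η, z⟫ = n := by
  obtain ⟨w, rfl⟩ := sg_list X hz
  exact ⟨_, inner_list X η hη w⟩

lemma mult_finite (X : Fin m → Euc s) (η : Euc s) (hη : ∀ j, ⟪η, X j⟫ = 1) {z : Euc s}
    (hz : z ∈ sgOf X) : {w : List (Fin m) | (w.map X).sum = z}.Finite := by
  obtain ⟨n, hn⟩ := sg_level X η hη hz
  rw [mult_set X η hη n z hn]
  exact (Set.toFinite _).image _

lemma mult_pos (X : Fin m → Euc s) (η : Euc s) (hη : ∀ j, ⟪η, X j⟫ = 1) {z : Euc s}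
    (hz : z ∈ sgOf X) : 0 < mult X z := by
  rw [mult, Set.ncard_pos (mult_finite X η hη hz)]
  exact sg_list X hz

lemma sg_add (X : Fin m → Euc s) {z w : Euc s} (hz : z ∈ sgOf X) (hw : w ∈ sgOf X) :
    z + w ∈ sgOf X := by
  obtain ⟨u, rfl⟩ := hz
  obtain ⟨v, rfl⟩ := hw
  exact ⟨u + v, by simp [add_smul, Finset.sum_add_distrib]⟩

lemma mult_mul (X : Fin m → Euc s) (η : Euc s) (hη : ∀ j, ⟪η, X j⟫ = 1) {z w : Euc s}
    (hz : z ∈ sgOf X) (hw : w ∈ sgOf X) : mult X z * mult X w ≤ mult X (z + w) := by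
  unfold mult
  rw [← Set.ncard_prod, ← Set.InjOn.ncard_image (f := fun p : List (Fin m) × List (Fin m) => p.1 ++ p.2)]
  · apply Set.ncard_le_ncard _ (mult_finite X η hη (sg_add X hz hw))
    rintro _ ⟨⟨a, b⟩, ⟨ha, hb⟩, rfl⟩
    have ha : (a.map X).sum = z := ha
    have hb : (b.map X).sum = w := hb
    show ((a ++ b).map X).sum = z + w
    simp [ha, hb]
  · rintro ⟨a, b⟩ ⟨ha, hb⟩ ⟨a', b'⟩ ⟨ha', hb'⟩ h
    have ha : (a.map X).sum = z := ha
    have ha' : (a'.map X).sum = z := ha'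
    have h1 := inner_list X η hη a
    have h2 := inner_list X η hη a'
    rw [ha] at h1
    rw [ha'] at h2
    have hl : a.length = a'.length := by
      rw [h1] at h2
      exact_mod_cast h2
    obtain ⟨h3, h4⟩ := List.append_inj h hl
    exact Prod.ext h3 h4

lemma mult_pow (X : Fin m → Euc s) (η : Euc s) (hη : ∀ j, ⟪η, X j⟫ = 1) {z : Euc s}
    (hz : z ∈ sgOf X) (j : ℕ) : ((j : ℝ) • z) ∈ sgOf X ∧ mult X z ^ j ≤ mult X ((j : ℝ) • z) := by
  induction j with
  | zero =>
    simp only [Nat.cast_zero, zero_smul, pow_zero]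
    exact ⟨sg_zero X, mult_pos X η hη (sg_zero X)⟩
  | succ j ih =>
    have : ((j + 1 : ℕ) : ℝ) • z = (j : ℝ) • z + z := by push_cast; rw [add_smul, one_smul]
    rw [this, pow_succ]
    exact ⟨sg_add X ih.1 hz, (Nat.mul_le_mul_right _ ih.2).trans (mult_mul X η hη ih.1 hz)⟩

/-- The Laplace transform. -/
def lapP (X : Fin m → Euc s) (ξ : Euc s) : ℝ := ∑ j, Real.exp ⟪ξ, X j⟫

lemma lapP_pow (X : Fin m → Euc s) (ξ : Euc s) (n : ℕ) :
    lapP X ξ ^ n = ∑ f : Fin n → Fin m, Real.exp ⟪ξ, ∑ i, X (f i)⟫ := by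
  rw [lapP, Fintype.sum_pow]
  simp [inner_sum, Real.exp_sum]

lemma lapP_pos (hm : 0 < m) (X : Fin m → Euc s) (ξ : Euc s) : 0 < lapP X ξ := by
  haveI : Nonempty (Fin m) := ⟨⟨0, hm⟩⟩
  exact Finset.sum_pos (fun _ _ => Real.exp_pos _) Finset.univ_nonempty

lemma log_mult_le (hm : 0 < m) (X : Fin m → Euc s) (η : Euc s) (hη : ∀ j, ⟪η, X j⟫ = 1)
    (ξ z : Euc s) (hz : z ∈ sgOf X) :
    Real.log (mult X z) ≤ ⟪Real.log (lapP X ξ) • η - ξ, z⟫ := by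
  classical
  obtain ⟨n, hn⟩ := sg_level X η hη hz
  have h1 : (mult X z : ℝ) * Real.exp ⟪ξ, z⟫ ≤ lapP X ξ ^ n := by
    rw [lapP_pow, mult_eq X η hη n z hn]
    rw [← nsmul_eq_mul, ← Finset.sum_const]
    calc _ = ∑ f ∈ Finset.univ.filter (fun f : Fin n → Fin m => ∑ i, X (f i) = z),
            Real.exp ⟪ξ, ∑ i, X (f i)⟫ := by
          apply Finset.sum_congr rfl
          intro f hf
          rw [(Finset.mem_filter.mp hf).2]
      _ ≤ _ := Finset.sum_le_sum_of_subset_of_nonneg (Finset.filter_subset _ _)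
          (fun _ _ _ => (Real.exp_pos _).le)
  have hp : (0 : ℝ) < mult X z := by exact_mod_cast mult_pos X η hη hz
  have h2 := Real.log_le_log (by positivity) h1
  rw [Real.log_mul hp.ne' (Real.exp_pos _).ne', Real.log_exp, Real.log_pow] at h2
  rw [inner_sub_left, real_inner_smul_left, hn]
  linarith

/-- The semigroup is relatively dense in the cone. -/
lemma cone_near (X : Fin m → Euc s) {x : Euc s} (hx : x ∈ coneOf X) :
    Metric.infDist x (sgOf X) ≤ ∑ j, ‖X j‖ := by
  obtain ⟨c, hc, rfl⟩ := hx
  have hmem : ∑ j, ((⌊c j⌋₊ : ℕ) : ℝ) • X j ∈ sgOf X := ⟨fun j => ⌊c j⌋₊, rfl⟩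
  refine (Metric.infDist_le_dist_of_mem hmem).trans ?_
  rw [dist_eq_norm, ← Finset.sum_sub_distrib]
  refine (norm_sum_le _ _).trans (Finset.sum_le_sum fun j _ => ?_)
  rw [← sub_smul, norm_smul, Real.norm_eq_abs]
  have h1 := Nat.floor_le (hc j)
  have h2 := Nat.lt_floor_add_one (c j)
  have : |c j - ⌊c j⌋₊| ≤ 1 := abs_le.mpr ⟨by linarith, by linarith⟩
  exact mul_le_of_le_one_left (norm_nonneg _) this

lemma cone_smul (X : Fin m → Euc s) {x : Euc s} (hx : x ∈ coneOf X) {t : ℝ} (ht : 0 ≤ t) :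
    t • x ∈ coneOf X := by
  obtain ⟨c, hc, rfl⟩ := hx
  exact ⟨fun j => t * c j, fun j => mul_nonneg ht (hc j), by simp [Finset.smul_sum, smul_smul]⟩

lemma sg_cone (X : Fin m → Euc s) {x : Euc s} (hx : x ∈ sgOf X) : x ∈ coneOf X := by
  obtain ⟨u, rfl⟩ := hx
  exact ⟨fun j => u j, fun j => Nat.cast_nonneg _, rfl⟩

lemma gamma_upper (hm : 0 < m) (X : Fin m → Euc s) (hX : IntegralVecs X) (η : Euc s)
    (hη : ∀ j, ⟪η, X j⟫ = 1) (ξ θ : Euc s) (hθ : θ ∈ coneOf X) (g : ℝ)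
    (hg : Tendsto (fun k : ℕ => Real.log (multC X ((k : ℝ) • θ)) / k) atTop (𝓝 g)) :
    g ≤ ⟪Real.log (lapP X ξ) • η - ξ, θ⟫ := by
  set v := Real.log (lapP X ξ) • η - ξ with hv
  have hlim : Tendsto (fun k : ℕ => ⟪v, θ⟫ + (‖v‖ * ∑ j, ‖X j‖) / (k : ℝ)) atTop (𝓝 (⟪v, θ⟫ + 0)) :=
    tendsto_const_nhds.add (tendsto_const_div_atTop_nhds_zero_nat _)
  rw [add_zero] at hlim
  refine le_of_tendsto_of_tendsto hg hlim ?_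
  filter_upwards [eventually_gt_atTop 0] with k hk
  have hk : (0 : ℝ) < k := by exact_mod_cast hk
  obtain ⟨z, hz, h1, h2⟩ := multC_spec X hX ((k : ℝ) • θ)
  have h3 := cone_near X (cone_smul X hθ hk.le)
  rw [← h1] at h3
  have h4 := log_mult_le hm X η hη ξ z hz
  rw [← hv] at h4
  rw [← h2]
  have h5 : ⟪v, z⟫ = k * ⟪v, θ⟫ + ⟪v, z - (k : ℝ) • θ⟫ := by
    rw [inner_sub_right, real_inner_smul_right]; ring
  have h6 : ⟪v, z - (k : ℝ) • θ⟫ ≤ ‖v‖ * ∑ j, ‖X j‖ := by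
    refine (real_inner_le_norm _ _).trans ?_
    rw [dist_comm, dist_eq_norm] at h3
    exact mul_le_mul_of_nonneg_left h3 (norm_nonneg _)
  rw [div_le_iff₀ hk, add_mul, div_mul_cancel₀ _ hk.ne']
  linarith

lemma dirichlet_seq (r : ℝ) (hr : 1 ≤ r) (K : ℕ) (hK : 0 < K) :
    ∃ k j : ℕ, K ≤ k ∧ |(k : ℝ) - j * r| < 1 / 2 := by
  obtain ⟨q, hq, -, h⟩ := Real.exists_nat_abs_mul_sub_round_le r (n := 4 * K) (by omega)
  have hqr : 1 ≤ (q : ℝ) * r := by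
    have : (1 : ℝ) ≤ q := by exact_mod_cast hq
    nlinarith
  have hK' : (0 : ℝ) < K := by exact_mod_cast hK
  have hp : 1 ≤ round ((q : ℝ) * r) := by
    rw [round_eq, Int.le_floor]; push_cast; linarith
  obtain ⟨p, hpp⟩ := Int.eq_ofNat_of_zero_le (by omega : 0 ≤ round ((q : ℝ) * r))
  rw [hpp] at h hp
  refine ⟨K * p, K * q, ?_, ?_⟩
  · have : 1 ≤ p := by exact_mod_cast hp
    nlinarith
  · have : (((K * p : ℕ) : ℝ) - (K * q : ℕ) * r) = - (K * (q * r - p)) := by push_cast; ring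
    rw [this, abs_neg, abs_mul, abs_of_pos hK']
    push_cast at h
    calc (K : ℝ) * |q * r - p| ≤ K * (1 / (4 * K + 1)) := mul_le_mul_of_nonneg_left h hK'.le
      _ < 1 / 2 := by
        rw [mul_one_div, div_lt_div_iff₀ (by positivity) (by norm_num)]; linarith

lemma gamma_lower (X : Fin m → Euc s) (hX : IntegralVecs X) (η : Euc s)
    (hη : ∀ j, ⟪η, X j⟫ = 1) (z : Euc s) (hz : z ∈ sgOf X) (hz0 : z ≠ 0) (g : ℝ)
    (hg : Tendsto (fun k : ℕ => Real.log (multC X ((k : ℝ) • (‖z‖⁻¹ • z))) / k) atTop (𝓝 g)) :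
    Real.log (mult X z) ≤ ‖z‖ * g := by
  have hr : 1 ≤ ‖z‖ := by
    have := sg_sep X hX hz (sg_zero X) hz0
    rwa [dist_zero_right] at this
  have hr0 : 0 < ‖z‖ := by linarith
  set L := Real.log (mult X z) with hL
  have hL0 : 0 ≤ L := Real.log_natCast_nonneg _
  have hlim : Tendsto (fun k : ℕ => L / ‖z‖ - (L / ‖z‖) / (k : ℝ)) atTop (𝓝 (L / ‖z‖ - 0)) :=
    tendsto_const_nhds.sub (tendsto_const_div_atTop_nhds_zero_nat _)
  rw [sub_zero] at hlim
  have hfr : ∃ᶠ k : ℕ in atTop, L / ‖z‖ - (L / ‖z‖) / (k : ℝ) ≤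
      Real.log (multC X ((k : ℝ) • (‖z‖⁻¹ • z))) / k := by
    rw [frequently_atTop]
    intro K
    obtain ⟨k, j, hk, hj⟩ := dirichlet_seq ‖z‖ hr (K + 1) (by omega)
    refine ⟨k, by omega, ?_⟩
    have hk0 : (0 : ℝ) < k := by
      have : 0 < k := by omega
      exact_mod_cast this
    obtain ⟨h1, h2⟩ := mult_pow X η hη hz j
    have hd : dist ((k : ℝ) • (‖z‖⁻¹ • z)) ((j : ℝ) • z) < 1 / 2 := by
      rw [dist_eq_norm, smul_smul, ← sub_smul, norm_smul, Real.norm_eq_abs]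
      rw [← abs_of_pos hr0, ← abs_mul, abs_of_pos hr0, sub_mul, mul_assoc,
        inv_mul_cancel₀ hr0.ne', mul_one]
      exact hj
    rw [multC_near X hX _ _ h1 hd]
    have hp : 0 < mult X z := mult_pos X η hη hz
    have h3 : (j : ℝ) * L ≤ Real.log (mult X ((j : ℝ) • z)) := by
      rw [hL, ← Real.log_pow]
      apply Real.log_le_log
      · have : (0 : ℝ) < mult X z := by exact_mod_cast hp
        positivity
      · exact_mod_cast h2
    rw [le_div_iff₀ hk0, sub_mul, div_mul_cancel₀ _ hk0.ne']
    refine le_trans ?_ h3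
    have h4 := (abs_lt.mp hj).2
    have : L / ‖z‖ * k - L / ‖z‖ = L * (k - 1) / ‖z‖ := by ring
    rw [this, div_le_iff₀ hr0]
    nlinarith
  have := le_of_tendsto_of_tendsto_of_frequently hlim hg hfr
  rwa [div_le_iff₀ hr0, mul_comm] at this

lemma lapP_le {m' : ℕ} (hm : 0 < m) (hm' : 0 < m')
    (X : Fin m → Euc s) (Y : Fin m' → Euc s)
    (hintX : IntegralVecs X) (hintY : IntegralVecs Y)
    (η : Euc s) (hηX : ∀ j, ⟪η, X j⟫ = 1) (hηY : ∀ j, ⟪η, Y j⟫ = 1)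
    (hcone : coneOf X = coneOf Y)
    (γ : Euc s → ℝ)
    (hγX : ∀ θ ∈ coneOf X, ‖θ‖ = 1 →
      Filter.Tendsto (fun k : ℕ => Real.log (multC X ((k : ℝ) • θ)) / k)
        Filter.atTop (nhds (γ θ)))
    (hγY : ∀ θ ∈ coneOf Y, ‖θ‖ = 1 →
      Filter.Tendsto (fun k : ℕ => Real.log (multC Y ((k : ℝ) • θ)) / k)
        Filter.atTop (nhds (γ θ))) (ξ : Euc s) : lapP X ξ ≤ lapP Y ξ := by
  classical
  have hPY := lapP_pos hm' Y ξ
  have hPX := lapP_pos hm X ξ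
  -- the key pointwise estimate
  have key : ∀ n : ℕ, 0 < n → ∀ z ∈ sgOf X, ⟪η, z⟫ = n →
      (mult X z : ℝ) * Real.exp ⟪ξ, z⟫ ≤ lapP Y ξ ^ n := by
    intro n hn z hz hzn
    have hz0 : z ≠ 0 := by
      rintro rfl
      rw [inner_zero_right] at hzn
      have : n = 0 := by exact_mod_cast hzn.symm
      omega
    have hr0 : 0 < ‖z‖ := norm_pos_iff.mpr hz0
    have hθ : ‖z‖⁻¹ • z ∈ coneOf X := cone_smul X (sg_cone X hz) (by positivity)
    have hθ1 : ‖‖z‖⁻¹ • z‖ = 1 := by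
      rw [norm_smul, norm_inv, norm_norm, inv_mul_cancel₀ hr0.ne']
    have h1 := gamma_lower X hintX η hηX z hz hz0 _ (hγX _ hθ hθ1)
    have h2 := gamma_upper hm' Y hintY η hηY ξ _ (hcone ▸ hθ) _ (hγY _ (hcone ▸ hθ) hθ1)
    have h3 := mul_le_mul_of_nonneg_left h2 hr0.le
    rw [real_inner_smul_right, ← mul_assoc, mul_inv_cancel₀ hr0.ne', one_mul, inner_sub_left,
      real_inner_smul_left, hzn] at h3
    have hp : (0 : ℝ) < mult X z := by exact_mod_cast mult_pos X η hηX hz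
    rw [← Real.exp_log hp, ← Real.exp_add, ← Real.exp_log (pow_pos hPY n), Real.log_pow]
    apply Real.exp_le_exp.mpr
    linarith
  have hbound : ∀ n : ℕ, 0 < n → lapP X ξ ^ n ≤ ((n : ℝ) + 1) ^ m * lapP Y ξ ^ n := by
    intro n hn
    set T : Finset (Euc s) := Finset.univ.image (fun f : Fin n → Fin m => ∑ i, X (f i)) with hT
    have hlev : ∀ f : Fin n → Fin m, ⟪η, ∑ i, X (f i)⟫ = n := by
      intro f; simp [inner_sum, hηX]
    have hTcard : T.card ≤ (n + 1) ^ m := by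
      have hsub : T ⊆ Finset.univ.image
          (fun u : Fin m → Fin (n + 1) => ∑ j, ((u j : ℕ) : ℝ) • X j) := by
        intro z hz
        obtain ⟨f, -, rfl⟩ := Finset.mem_image.mp hz
        refine Finset.mem_image.mpr ⟨fun j => ⟨(Finset.univ.filter (fun i => f i = j)).card, ?_⟩,
          Finset.mem_univ _, ?_⟩
        · have := Finset.card_le_univ (Finset.univ.filter (fun i => f i = j))
          simp only [Fintype.card_fin] at this
          omega
        · rw [← Finset.sum_fiberwise Finset.univ f]
          apply Finset.sum_congr rfl
          intro j _
          rw [Finset.sum_congr rfl (g := fun _ => X j)]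
          · rw [Finset.sum_const, Nat.cast_smul_eq_nsmul]
          · intro i hi
            rw [(Finset.mem_filter.mp hi).2]
      refine (Finset.card_le_card hsub).trans (Finset.card_image_le.trans ?_)
      simp
    have h1 : lapP X ξ ^ n ≤ ∑ z ∈ T, lapP Y ξ ^ n := by
      rw [lapP_pow, ← Finset.sum_fiberwise_of_maps_to (t := T) (g := fun f : Fin n → Fin m => ∑ i, X (f i))
        (fun f _ => Finset.mem_image_of_mem _ (Finset.mem_univ f))]
      apply Finset.sum_le_sum
      intro z hz
      obtain ⟨f, -, hf⟩ := Finset.mem_image.mp hz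
      have hzn : ⟪η, z⟫ = n := by rw [← hf]; exact hlev f
      have hzs : z ∈ sgOf X := by
        have := list_sg X (List.ofFn f)
        rw [List.map_ofFn, List.sum_ofFn] at this
        rw [← hf]; exact this
      refine le_trans (le_of_eq ?_) (key n hn z hzs hzn)
      rw [mult_eq X η hηX n z hzn, ← nsmul_eq_mul, ← Finset.sum_const]
      apply Finset.sum_congr rfl
      intro f hf
      rw [(Finset.mem_filter.mp hf).2]
    rw [Finset.sum_const, nsmul_eq_mul] at h1
    refine h1.trans (mul_le_mul_of_nonneg_right ?_ (pow_pos hPY n).le)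
    exact_mod_cast hTcard
  by_contra! hlt
  set r := lapP X ξ / lapP Y ξ with hr
  have hr1 : 1 < r := (one_lt_div hPY).mpr hlt
  have hlim := tendsto_pow_const_div_const_pow_of_one_lt m hr1
  have hlim2 := (tendsto_add_atTop_iff_nat 1).mpr hlim
  have hc : (0 : ℝ) < r⁻¹ := by positivity
  obtain ⟨n, hn, hn1⟩ := ((hlim2.eventually_lt_const hc).and (eventually_gt_atTop 0)).exists
  have hb := hbound n hn1
  have hrn : 0 < r ^ n := by positivity
  have hb' : r ^ n ≤ ((n : ℝ) + 1) ^ m := by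
    rw [hr, div_pow, div_le_iff₀ (pow_pos hPY n)]
    exact hb
  rw [div_lt_iff₀ (by positivity), pow_succ, mul_comm (r ^ n), ← mul_assoc,
    inv_mul_cancel₀ (by positivity), one_mul] at hn
  push_cast at hn
  linarith

/-- The character `ξ ↦ exp ⟪ξ, v⟫`. -/
def expChar (v : Euc s) : Multiplicative (Euc s) →* ℝ where
  toFun ξ := Real.exp ⟪ξ.toAdd, v⟫
  map_one' := by simp
  map_mul' a b := by simp [inner_add_left, Real.exp_add]

lemma expChar_inj : Function.Injective (expChar (s := s)) := by
  intro v w h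
  have h1 : ∀ ξ : Euc s, ⟪ξ, v⟫ = ⟪ξ, w⟫ := by
    intro ξ
    have := DFunLike.congr_fun h (Multiplicative.ofAdd ξ)
    exact Real.exp_injective this
  exact ext_inner_left ℝ h1

lemma perm_of_lapP {m' : ℕ} (X : Fin m → Euc s) (Y : Fin m' → Euc s)
    (h : ∀ ξ, lapP X ξ = lapP Y ξ) : ∃ e : Fin m ≃ Fin m', ∀ j, Y (e j) = X j := by
  classical
  have hli := (linearIndependent_monoidHom (Multiplicative (Euc s)) ℝ).comp _ (expChar_inj (s := s))
  have heq : (∑ j, Finsupp.single (X j) (1 : ℝ)) = ∑ j, Finsupp.single (Y j) (1 : ℝ) := by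
    apply hli
    rw [map_sum, map_sum]
    simp only [Finsupp.linearCombination_single, one_smul, Function.comp]
    funext ξ
    rw [Finset.sum_apply, Finset.sum_apply]
    exact h ξ.toAdd
  have hc : ∀ v, Nonempty ({j // X j = v} ≃ {j // Y j = v}) := by
    intro v
    have := DFunLike.congr_fun heq v
    simp only [Finsupp.finsetSum_apply, Finsupp.single_apply, Finset.sum_boole] at this
    refine ⟨Fintype.equivOfCardEq ?_⟩
    rw [Fintype.card_subtype, Fintype.card_subtype]
    exact_mod_cast this
  exact ⟨Equiv.ofFiberEquiv (fun v => (hc v).some), fun j => Equiv.ofFiberEquiv_map _ j⟩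

end RigidityHelpers

/-- Rigidity: if `X` and `Y` are both `η`-coplanar, generate the same cone and
have the same directional growth function, then `m = m'` and `X` is a permutation
of `Y`. -/
theorem stmt16 {s m m' : ℕ} (hs : 1 ≤ s) (hm : 2 ≤ m) (hm' : 2 ≤ m')
    (X : Fin m → Euc s) (Y : Fin m' → Euc s)
    (hintX : IntegralVecs X) (hintY : IntegralVecs Y)
    (hspanX : Submodule.span ℝ (Set.range X) = ⊤)
    (hspanY : Submodule.span ℝ (Set.range Y) = ⊤)
    (α : Euc s) (hαX : ∀ j, 0 < ⟪X j, α⟫)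
    (α' : Euc s) (hαY : ∀ j, 0 < ⟪Y j, α'⟫)
    (η : Euc s) (hηX : ∀ j, ⟪η, X j⟫ = 1) (hηY : ∀ j, ⟪η, Y j⟫ = 1)
    (hcone : coneOf X = coneOf Y)
    (γ : Euc s → ℝ)
    (hγX : ∀ θ ∈ coneOf X, ‖θ‖ = 1 →
      Filter.Tendsto (fun k : ℕ => Real.log (multC X ((k : ℝ) • θ)) / k)
        Filter.atTop (nhds (γ θ)))
    (hγY : ∀ θ ∈ coneOf Y, ‖θ‖ = 1 →
      Filter.Tendsto (fun k : ℕ => Real.log (multC Y ((k : ℝ) • θ)) / k)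
        Filter.atTop (nhds (γ θ))) :
    m = m' ∧ ∃ e : Fin m ≃ Fin m', ∀ j, Y (e j) = X j := by
  obtain ⟨e, he⟩ := perm_of_lapP X Y (fun ξ => le_antisymm
    (lapP_le (by omega) (by omega) X Y hintX hintY η hηX hηY hcone γ hγX hγY ξ)
    (lapP_le (by omega) (by omega) Y X hintY hintX η hηY hηX hcone.symm γ hγY hγX ξ))
  exact ⟨by simpa using Fintype.card_congr e, e, he⟩
end
end
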